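/- Let ξ, η ∈ F_q((T^{-1})) be transcendental over F_q(T), and let F(X,Y) ∈ (F_q[T])[X,Y] be a polynomial, irreducible and primitive in X and Y, with F(ξ,η) = 0; write M = deg_X F and N = deg_Y F. Then for every integer n ≥ 1, w_n(ξ) ≤ M − 1 + M · w_{nN}(η), and consequently w(ξ) ≤ MN · w(η). -/

import Mathlib

open Polynomial Filter Set
open scoped Classical

noncomputable section

namespace OotoT

variable (Fq : Type) [Field Fq]

/-- We model the field `F_q((T⁻¹))` of Laurent series in `T⁻¹` as `LaurentSeries Fq`,
whose canonical variable `u` plays the role of `T⁻¹`.  Thus `T` itself is `u⁻¹`. -/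
def Tel : LaurentSeries Fq := (HahnSeries.single (1 : ℤ) (1 : Fq))⁻¹

/-- The canonical ring embedding `F_q[T] → F_q((T⁻¹))`, sending `T ↦ u⁻¹`. -/
def ringHomT : Polynomial Fq →+* LaurentSeries Fq :=
  Polynomial.eval₂RingHom (HahnSeries.C : Fq →+* LaurentSeries Fq) (Tel Fq)

/-- The absolute value on `F_q((T⁻¹))`: `|0| = 0` and `|ξ| = q^{-N}` where
`ξ = Σ_{n ≥ N} a_n T^{-n}` with `a_N ≠ 0`; in our model `N` is the order of `ξ`
as a Hahn series in `u = T⁻¹`. -/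
def absL (q : ℕ) (ξ : LaurentSeries Fq) : ℝ :=
  if ξ = 0 then 0 else (q : ℝ) ^ (-ξ.order)

/-- Evaluation of a polynomial `P(X) ∈ (F_q[T])[X]` at `ξ ∈ F_q((T⁻¹))`. -/
def evalP (ξ : LaurentSeries Fq) (P : Polynomial (Polynomial Fq)) : LaurentSeries Fq :=
  Polynomial.eval₂ (ringHomT Fq) ξ P

/-- The height of `P(X) ∈ (F_q[T])[X]`: the maximum of the absolute values of its
coefficients.  A nonzero `c ∈ F_q[T]` has `|c| = q^{deg c}`, so for `P ≠ 0` the height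
is `q` raised to the maximal degree of a (nonzero) coefficient of `P`. -/
def heightP (q : ℕ) (P : Polynomial (Polynomial Fq)) : ℝ :=
  if P = 0 then 0 else (q : ℝ) ^ (P.support.sup fun i => (P.coeff i).natDegree)

/-- `w_n(ξ)`: the supremum (in the extended reals) of the real numbers `w` such that
`0 < |P(ξ)| ≤ H(P)^{-w}` for infinitely many `P(X) ∈ (F_q[T])[X]` of degree at most `n`. -/
def wn (q : ℕ) (n : ℕ) (ξ : LaurentSeries Fq) : EReal :=
  sSup ((fun w : ℝ => (w : EReal)) ''
    {w : ℝ | {P : Polynomial (Polynomial Fq) | P.natDegree ≤ n ∧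
      0 < absL Fq q (evalP Fq ξ P) ∧
      absL Fq q (evalP Fq ξ P) ≤ heightP Fq q P ^ (-w)}.Infinite})

/-- `w(ξ) = limsup_{n→∞} w_n(ξ)/n`. -/
def wB (q : ℕ) (ξ : LaurentSeries Fq) : EReal :=
  Filter.limsup (fun n : ℕ => wn Fq q n ξ / (n : EReal)) Filter.atTop

/-- `ξ` is an `A`-number if `w(ξ) = 0`. -/
def IsANumber (q : ℕ) (ξ : LaurentSeries Fq) : Prop := wB Fq q ξ = 0

/-- `ξ` is an `S`-number if `0 < w(ξ) < +∞`. -/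
def IsSNumber (q : ℕ) (ξ : LaurentSeries Fq) : Prop := 0 < wB Fq q ξ ∧ wB Fq q ξ < ⊤

/-- `ξ` is a `T`-number if `w(ξ) = +∞` and `w_n(ξ) < +∞` for all `n ≥ 1`. -/
def IsTNumber (q : ℕ) (ξ : LaurentSeries Fq) : Prop :=
  wB Fq q ξ = ⊤ ∧ ∀ n : ℕ, 1 ≤ n → wn Fq q n ξ < ⊤

/-- `ξ` is a `U`-number if `w(ξ) = +∞` and `w_n(ξ) = +∞` for some `n ≥ 1`. -/
def IsUNumber (q : ℕ) (ξ : LaurentSeries Fq) : Prop :=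
  wB Fq q ξ = ⊤ ∧ ∃ n : ℕ, 1 ≤ n ∧ wn Fq q n ξ = ⊤

/-- The type `t(ξ) = limsup_{n→∞} (log w_n(ξ))/(log n)` of a `T`-number (as an
extended real; for a `T`-number each `w_n(ξ)` is a finite real, recovered by `toReal`). -/
def typeT (q : ℕ) (ξ : LaurentSeries Fq) : EReal :=
  Filter.limsup
    (fun n : ℕ => ((Real.log (wn Fq q n ξ).toReal / Real.log n : ℝ) : EReal)) Filter.atTop

/-! ### The algebraic closure side -/

/-- The algebraic closure of `F_q((T⁻¹))`. -/
abbrev AC := AlgebraicClosure (LaurentSeries Fq)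

/-- The canonical embedding of `F_q((T⁻¹))` into its algebraic closure. -/
def iota : LaurentSeries Fq →+* AC Fq := algebraMap _ _

/-- The embedding `F_q[T] → AC`. -/
def ringHomTC : Polynomial Fq →+* AC Fq := (iota Fq).comp (ringHomT Fq)

/-- Evaluation of `P(X) ∈ (F_q[T])[X]` at an element of the algebraic closure. -/
def evalPC (α : AC Fq) (P : Polynomial (Polynomial Fq)) : AC Fq :=
  Polynomial.eval₂ (ringHomTC Fq) α P

/-- `P ∈ (F_q[T])[X]` is *the* minimal polynomial of `α`: it is non-constant, irreducible,
primitive, its leading coefficient is monic (in `T`), and `P(α) = 0`.  For `α` algebraic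
over `F_q(T)` such a polynomial exists and is unique. -/
def IsMinPolyOf (α : AC Fq) (P : Polynomial (Polynomial Fq)) : Prop :=
  0 < P.natDegree ∧ Irreducible P ∧ P.IsPrimitive ∧ P.leadingCoeff.Monic ∧ evalPC Fq α P = 0

/-- `α` is algebraic over `F_q(T)`. -/
def IsAlgT (α : AC Fq) : Prop := ∃ P, IsMinPolyOf Fq α P

/-- The degree of an algebraic `α`: the degree of its minimal polynomial. -/
def degT (α : AC Fq) : ℕ := if h : IsAlgT Fq α then h.choose.natDegree else 0

/-- The height of an algebraic `α`: the height of its minimal polynomial. -/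
def heightT (q : ℕ) (α : AC Fq) : ℝ := if h : IsAlgT Fq α then heightP Fq q h.choose else 0

/-- The unique extension of the absolute value to the algebraic closure of `F_q((T⁻¹))`,
given by the standard formula `|x| = |N_{K(x)/K}(x)|^{1/[K(x):K]}`, i.e.
`|x| = |c₀|^{1/d}` where `c₀` is the constant coefficient and `d` the degree of the
minimal polynomial of `x` over `K = F_q((T⁻¹))`. -/
def absC (q : ℕ) (x : AC Fq) : ℝ :=
  absL Fq q ((minpoly (LaurentSeries Fq) x).coeff 0) ^
    (((minpoly (LaurentSeries Fq) x).natDegree : ℝ)⁻¹)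

/-- `w_n^*(ξ)`: the supremum (in the extended reals) of the real numbers `w` such that
`0 < |ξ - α| ≤ H(α)^{-w-1}` for infinitely many `α` algebraic over `F_q(T)` of degree
at most `n`. -/
def wnStar (q : ℕ) (n : ℕ) (ξ : LaurentSeries Fq) : EReal :=
  sSup ((fun w : ℝ => (w : EReal)) ''
    {w : ℝ | {α : AC Fq | IsAlgT Fq α ∧ degT Fq α ≤ n ∧
      0 < absC Fq q (iota Fq ξ - α) ∧
      absC Fq q (iota Fq ξ - α) ≤ heightT Fq q α ^ (-w - 1)}.Infinite})

/-- `w^*(ξ) = limsup_{n→∞} w_n^*(ξ)/n`. -/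
def wBStar (q : ℕ) (ξ : LaurentSeries Fq) : EReal :=
  Filter.limsup (fun n : ℕ => wnStar Fq q n ξ / (n : EReal)) Filter.atTop

/-- `ξ` is an `A*`-number if `w^*(ξ) = 0`. -/
def IsAStarNumber (q : ℕ) (ξ : LaurentSeries Fq) : Prop := wBStar Fq q ξ = 0

/-- `ξ` is a `T*`-number if `w^*(ξ) = +∞` and `w_n^*(ξ) < +∞` for all `n ≥ 1`. -/
def IsTStarNumber (q : ℕ) (ξ : LaurentSeries Fq) : Prop :=
  wBStar Fq q ξ = ⊤ ∧ ∀ n : ℕ, 1 ≤ n → wnStar Fq q n ξ < ⊤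

/-- The `*`-type `t^*(ξ) = limsup_{n→∞} (log w_n^*(ξ))/(log n)` of a `T*`-number. -/
def typeTStar (q : ℕ) (ξ : LaurentSeries Fq) : EReal :=
  Filter.limsup
    (fun n : ℕ => ((Real.log (wnStar Fq q n ξ).toReal / Real.log n : ℝ) : EReal)) Filter.atTop

/-! ### The Laurent series `ξ(r, m)` -/

/-- `r_j = r^{m_0 m_1 ⋯ m_j}`. -/
def rr (r : ℕ) (m : ℕ → ℕ) (j : ℕ) : ℕ := r ^ (∏ i ∈ Finset.range (j + 1), m i)

/-- `α_j(r, m) = Σ_{n=1}^∞ T^{-r_j^n}`, i.e. the power series in `u = T⁻¹` whose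
`k`-th coefficient is `1` exactly when `k = r_j^n` for some `n ≥ 1`. -/
def alphaJ (r : ℕ) (m : ℕ → ℕ) (j : ℕ) : LaurentSeries Fq :=
  HahnSeries.ofPowerSeries ℤ Fq (PowerSeries.mk fun k =>
    if ∃ n : ℕ, 1 ≤ n ∧ k = rr r m j ^ n then 1 else 0)

/-- `ξ_a(r, m) = Σ_{j=0}^∞ a_j α_j(r, m)`, described coefficientwise: the coefficient of
`T^{-k}` is the (finite) sum over `j` of `a_j` times the coefficient of `T^{-k}` in
`α_j(r, m)`. -/
def xiA (r : ℕ) (m : ℕ → ℕ) (a : ℕ → ℕ) : LaurentSeries Fq :=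
  HahnSeries.ofPowerSeries ℤ Fq (PowerSeries.mk fun k =>
    ∑ᶠ j : ℕ, (a j : Fq) * (if ∃ n : ℕ, 1 ≤ n ∧ k = rr r m j ^ n then 1 else 0))

/-- `ξ(r, m) = Σ_{j=0}^∞ α_j(r, m)`. -/
def xi (r : ℕ) (m : ℕ → ℕ) : LaurentSeries Fq := xiA Fq r m fun _ => 1

/-! ### Algebraicity and algebraic dependence over `F_q(T)` for Laurent series -/

/-- `ξ ∈ F_q((T⁻¹))` is algebraic over `F_q(T)`. -/
def IsAlgLS (ξ : LaurentSeries Fq) : Prop :=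
  ∃ P : Polynomial (Polynomial Fq), P ≠ 0 ∧ evalP Fq ξ P = 0

/-- Evaluation of a two-variable polynomial `F(X, Y) ∈ (F_q[T])[X, Y]` (coded as an
iterated polynomial ring, `T` innermost, then `X`, then `Y`) at `(ξ, η)`. -/
def evalXY (ξ η : LaurentSeries Fq) (F : Polynomial (Polynomial (Polynomial Fq))) :
    LaurentSeries Fq :=
  Polynomial.eval₂ (Polynomial.eval₂RingHom (ringHomT Fq) ξ) η F

/-- `ξ` and `η` are algebraically dependent over `F_q(T)`. -/
def AlgDep (ξ η : LaurentSeries Fq) : Prop :=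
  ∃ F : Polynomial (Polynomial (Polynomial Fq)), F ≠ 0 ∧ evalXY Fq ξ η F = 0

/-- `deg_X` of `F(X, Y) ∈ (F_q[T])[X, Y]` in our encoding. -/
def degX (F : Polynomial (Polynomial (Polynomial Fq))) : ℕ :=
  F.support.sup fun i => (F.coeff i).natDegree

/-- `F(X, Y) ∈ (F_q[T])[X, Y]` is primitive (in `X` and `Y`): no non-unit of `F_q[T]`
divides all of its coefficients. -/
def IsPrimitiveXY (F : Polynomial (Polynomial (Polynomial Fq))) : Prop :=
  ∀ c : Polynomial Fq, (∀ i j : ℕ, c ∣ ((F.coeff i).coeff j)) → IsUnit c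

end OotoT

open OotoT

namespace OotoT

section AbsoluteValue

variable {Fq : Type} [Field Fq] {q : ℕ}

lemma absL_of_ne_zero {x : LaurentSeries Fq} (hx : x ≠ 0) :
    absL Fq q x = (q : ℝ) ^ (-x.order) := by
  simp [absL, hx]

/-- The absolute value `absL`, bundled. -/
def absValue (Fq : Type) [Field Fq] {q : ℕ} (hq : 1 < q) : AbsoluteValue (LaurentSeries Fq) ℝ where
  toFun := absL Fq q
  map_mul' x y := by
    by_cases hx : x = 0
    · simp [absL, hx]
    by_cases hy : y = 0
    · simp [absL, hy]
    have h0 : (q : ℝ) ≠ 0 := by positivity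
    rw [absL_of_ne_zero hx, absL_of_ne_zero hy, absL_of_ne_zero (mul_ne_zero hx hy),
      HahnSeries.order_mul hx hy, neg_add, zpow_add₀ h0]
  nonneg' x := by
    unfold absL
    split_ifs <;> positivity
  eq_zero' x := by
    have h0 : (q : ℝ) ≠ 0 := by positivity
    by_cases hx : x = 0
    · simp [absL, hx]
    · simp [absL, hx, zpow_ne_zero _ h0]
  add_le' x y := by
    have hnn (z : LaurentSeries Fq) : 0 ≤ absL Fq q z := by
      unfold absL
      split_ifs <;> positivity
    by_cases hx : x = 0
    · simp [absL, hx]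
    by_cases hy : y = 0
    · simp [absL, hy]
    by_cases hxy : x + y = 0
    · have := add_nonneg (hnn x) (hnn y)
      simpa [hxy, absL] using this
    have h1 : (1 : ℝ) ≤ q := by exact_mod_cast hq.le
    have h := HahnSeries.min_order_le_order_add hxy
    rcases min_le_iff.1 h with h | h
    · refine le_trans ?_ (le_add_of_nonneg_right (hnn y))
      rw [absL_of_ne_zero hxy, absL_of_ne_zero hx]
      exact zpow_le_zpow_right₀ h1 (by lia)
    · refine le_trans ?_ (le_add_of_nonneg_left (hnn x))
      rw [absL_of_ne_zero hxy, absL_of_ne_zero hy]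
      exact zpow_le_zpow_right₀ h1 (by lia)

variable (hq : 1 < q)

lemma absValue_apply (x : LaurentSeries Fq) : absValue Fq hq x = absL Fq q x := rfl

lemma isNonarchimedean_absValue : IsNonarchimedean (absValue Fq hq) := by
  intro x y
  simp only [absValue_apply]
  by_cases hx : x = 0
  · simp [hx]
  by_cases hy : y = 0
  · simp [hy]
  by_cases hxy : x + y = 0
  · rw [hxy, ← absValue_apply hq, ← absValue_apply hq, ← absValue_apply hq, map_zero]
    exact le_max_of_le_left (AbsoluteValue.nonneg _ _)
  have h1 : (1 : ℝ) ≤ q := by exact_mod_cast hq.le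
  have h := HahnSeries.min_order_le_order_add hxy
  rw [absL_of_ne_zero hxy, absL_of_ne_zero hy, absL_of_ne_zero hx]
  refine le_max_iff.2 ((min_le_iff.1 h).imp (fun h ↦ ?_) fun h ↦ ?_) <;>
    exact zpow_le_zpow_right₀ h1 (by lia)

lemma ringHomT_monomial (k : ℕ) (c : Fq) :
    ringHomT Fq (monomial k c) = HahnSeries.single (-(k : ℤ)) c := by
  have hT : Tel Fq = HahnSeries.single (-1) 1 := by
    simp [Tel, HahnSeries.inv_single]
  simp [ringHomT, hT, eval₂_monomial, HahnSeries.single_pow, HahnSeries.C_apply]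

lemma absValue_ringHomT_le (c : Fq[X]) :
    absValue Fq hq (ringHomT Fq c) ≤ (q : ℝ) ^ c.natDegree := by
  have h1 : (1 : ℝ) ≤ q := by exact_mod_cast hq.le
  conv_lhs => rw [c.as_sum_range, map_sum]
  refine Finset.sum_induction _ (fun x ↦ absValue Fq hq x ≤ (q : ℝ) ^ c.natDegree) ?_ ?_ ?_
  · exact fun a b ha hb ↦ (isNonarchimedean_absValue hq a b).trans (max_le ha hb)
  · rw [map_zero]
    positivity
  · intro i hi
    rw [ringHomT_monomial, absValue_apply]
    by_cases hc : c.coeff i = 0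
    · simp [hc, absL]
    · rw [absL_of_ne_zero (by simpa using hc), HahnSeries.order_single hc, neg_neg, zpow_natCast]
      exact pow_le_pow_right₀ h1 (by simpa [Nat.lt_succ_iff] using hi)

lemma exists_coeff_sub_ringHomT_eq_zero (m : ℕ) (x : LaurentSeries Fq)
    (hx : ∀ j < -(m : ℤ), x.coeff j = 0) :
    ∃ a : Fq[X], ∀ j < 0, (x - ringHomT Fq a).coeff j = 0 := by
  induction m generalizing x with
  | zero => exact ⟨0, by simpa using hx⟩
  | succ m ih =>
    obtain ⟨a, ha⟩ := ih (x - ringHomT Fq (monomial (m + 1) (x.coeff (-(m + 1 : ℕ))))) (by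
      intro j hj
      rw [ringHomT_monomial, HahnSeries.coeff_sub]
      by_cases h : j = -((m + 1 : ℕ) : ℤ)
      · simp [h]
      · rw [HahnSeries.coeff_single_of_ne h, sub_zero, hx j (by push_cast at h ⊢; lia)])
    refine ⟨a + monomial (m + 1) (x.coeff (-(m + 1 : ℕ))), fun j hj ↦ ?_⟩
    rw [map_add, add_comm, ← sub_sub]
    exact ha j hj

lemma exists_absValue_sub_ringHomT_le_one (x : LaurentSeries Fq) :
    ∃ a : Fq[X], absValue Fq hq (x - ringHomT Fq a) ≤ 1 := by
  have h1 : (1 : ℝ) ≤ q := by exact_mod_cast hq.le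
  obtain ⟨a, ha⟩ := exists_coeff_sub_ringHomT_eq_zero (-x.order).toNat x
    (fun j hj ↦ HahnSeries.coeff_eq_zero_of_lt_order (by lia))
  refine ⟨a, ?_⟩
  rw [absValue_apply]
  by_cases h : x - ringHomT Fq a = 0
  · simp [h, absL]
  · rw [absL_of_ne_zero h]
    exact zpow_le_one_of_nonpos₀ h1 (by
      simpa using (HahnSeries.le_order_iff_forall h).2 ha)

end AbsoluteValue

section Resultant

lemma natDegree_resultant_le {A : Type*} [CommRing A] (f g : A[X][X]) (m n a b : ℕ)
    (hf : ∀ i, (f.coeff i).natDegree ≤ a) (hg : ∀ i, (g.coeff i).natDegree ≤ b) :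
    (resultant f g m n).natDegree ≤ m * b + n * a := by
  rw [resultant, Matrix.det_apply']
  refine natDegree_sum_le_of_forall_le _ _ fun σ _ ↦ ?_
  refine natDegree_mul_le.trans ?_
  rw [natDegree_intCast, zero_add]
  refine (natDegree_prod_le _ _).trans ?_
  rw [Fin.sum_univ_add]
  refine add_le_add ?_ ?_
  · refine (Finset.sum_le_card_nsmul _ _ b fun j _ ↦ ?_).trans (by simp)
    simp only [sylvester, Matrix.of_apply, Fin.addCases_left]
    split_ifs <;> simp [hg]
  · refine (Finset.sum_le_card_nsmul _ _ a fun j _ ↦ ?_).trans (by simp)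
    simp only [sylvester, Matrix.of_apply, Fin.addCases_right]
    split_ifs <;> simp [hf]

lemma sum_ite_coeff_mul_pow {A : Type*} [CommRing A] (f : A[X]) (x : A) {m k d : ℕ}
    (hf : f.natDegree ≤ m) (hd : k + m < d) :
    ∑ i : Fin d, x ^ (i : ℕ) * (if (i : ℕ) ∈ Set.Icc k (k + m) then f.coeff (i - k) else 0) =
      x ^ k * f.eval x := by
  rw [Fin.sum_univ_eq_sum_range
    (fun i ↦ x ^ i * (if i ∈ Set.Icc k (k + m) then f.coeff (i - k) else 0)) d,
    eval_eq_sum_range' (Nat.lt_succ_of_le hf), Finset.mul_sum]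
  have hsub : Finset.Ico k (k + (m + 1)) ⊆ Finset.range d := by
    intro i hi
    simp only [Finset.mem_Ico, Finset.mem_range] at hi ⊢
    lia
  rw [← Finset.sum_subset hsub, Finset.sum_Ico_eq_sum_range]
  · simp only [add_tsub_cancel_left]
    refine Finset.sum_congr rfl fun i hi ↦ ?_
    rw [Finset.mem_range] at hi
    rw [if_pos ⟨by lia, by lia⟩, pow_add]
    ring
  · intro i _ hi
    rw [if_neg, mul_zero]
    simp only [Finset.mem_Ico, Set.mem_Icc] at hi ⊢
    lia

lemma resultant_eq_det_updateRow {A : Type*} [CommRing A] (f g : A[X]) (x : A) {m n : ℕ}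
    (hf : f.natDegree ≤ m) (hg : g.natDegree ≤ n) (i₀ : Fin (m + n)) (hi₀ : (i₀ : ℕ) = 0) :
    resultant f g m n = ((sylvester f g m n).updateRow i₀
      (Fin.append (fun j : Fin m ↦ x ^ (j : ℕ) * g.eval x)
        (fun j : Fin n ↦ x ^ (j : ℕ) * f.eval x))).det := by
  have h := Matrix.det_updateRow_sum (sylvester f g m n) i₀ (fun i ↦ x ^ (i : ℕ))
  rw [hi₀, pow_zero, one_smul] at h
  rw [resultant, ← h]
  congr 2
  ext j
  rw [Finset.sum_apply]
  refine j.addCases (fun j ↦ ?_) fun j ↦ ?_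
  · simp only [Pi.smul_apply, smul_eq_mul, sylvester, Matrix.of_apply, Fin.addCases_left,
      Fin.append_left]
    exact sum_ite_coeff_mul_pow g x hg (by lia)
  · simp only [Pi.smul_apply, smul_eq_mul, sylvester, Matrix.of_apply, Fin.addCases_right,
      Fin.append_right]
    exact sum_ite_coeff_mul_pow f x hf (by lia)

lemma map_det_le {K ι : Type*} [Field K] [Fintype ι] [DecidableEq ι] {v : AbsoluteValue K ℝ}
    (hv : IsNonarchimedean v) (B : Matrix ι ι K) {c : ℝ}
    (h : ∀ σ : Equiv.Perm ι, ∏ i, v (B (σ i) i) ≤ c) : v B.det ≤ c := by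
  have hc : 0 ≤ c := (Finset.prod_nonneg fun i _ ↦ v.nonneg _).trans (h 1)
  rw [Matrix.det_apply]
  refine Finset.sum_induction _ (fun x ↦ v x ≤ c)
    (fun a b ha hb ↦ (hv a b).trans (max_le ha hb)) (by simpa using hc) fun σ _ ↦ ?_
  rcases Int.units_eq_one_or (Equiv.Perm.sign σ) with hs | hs <;> simpa [hs] using h σ

lemma map_resultant_le {K : Type*} [Field K] {v : AbsoluteValue K ℝ}
    (hv : IsNonarchimedean v) (f g : K[X]) (x : K) {m n : ℕ} {H c : ℝ}
    (hf : f.natDegree ≤ m) (hg : g.natDegree ≤ n + 1) (hx : g.eval x = 0)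
    (hH : ∀ i, v (f.coeff i) ≤ H) (hc : ∀ i, v (g.coeff i) ≤ c) :
    v (resultant f g m (n + 1)) ≤ c ^ m * (max 1 (v x) ^ n * v (f.eval x) * H ^ n) := by
  have hH0 : 0 ≤ H := (v.nonneg _).trans (hH 0)
  have hc0 : 0 ≤ c := (v.nonneg _).trans (hc 0)
  let i₀ : Fin (m + (n + 1)) := ⟨0, by lia⟩
  rw [resultant_eq_det_updateRow f g x hf hg i₀ rfl]
  refine map_det_le hv _ fun σ ↦ ?_
  set B := (sylvester f g m (n + 1)).updateRow i₀
      (Fin.append (fun j : Fin m ↦ x ^ (j : ℕ) * g.eval x)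
        (fun j : Fin (n + 1) ↦ x ^ (j : ℕ) * f.eval x)) with hB
  have hleft (i : Fin (m + (n + 1))) (j : Fin m) : v (B i (Fin.castAdd (n + 1) j)) ≤ c := by
    by_cases hi : i = i₀
    · simpa [hB, hi, hx] using hc0
    · rw [hB, Matrix.updateRow_ne hi]
      simp only [sylvester, Matrix.of_apply, Fin.addCases_left]
      split_ifs <;> simp [hc, hc0]
  have hright (i : Fin (m + (n + 1))) (j : Fin (n + 1)) (hi : i ≠ i₀) :
      v (B i (Fin.natAdd m j)) ≤ H := by
    rw [hB, Matrix.updateRow_ne hi]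
    simp only [sylvester, Matrix.of_apply, Fin.addCases_right]
    split_ifs <;> simp [hH, hH0]
  have hrow (j : Fin (n + 1)) :
      v (B i₀ (Fin.natAdd m j)) ≤ max 1 (v x) ^ n * v (f.eval x) := by
    simp only [hB, Matrix.updateRow_self, Fin.append_right, map_mul, map_pow]
    refine mul_le_mul_of_nonneg_right ?_ (v.nonneg _)
    calc v x ^ (j : ℕ) ≤ max 1 (v x) ^ (j : ℕ) :=
          pow_le_pow_left₀ (v.nonneg _) (le_max_right _ _) _
      _ ≤ max 1 (v x) ^ n := pow_le_pow_right₀ (le_max_left _ _) (by lia)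
  have hrhs : 0 ≤ max 1 (v x) ^ n * v (f.eval x) * H ^ n := by
    have := v.nonneg (f.eval x)
    positivity
  obtain ⟨k, hk⟩ := σ.surjective i₀
  revert hk
  refine k.addCases (fun j hk ↦ ?_) fun j hk ↦ ?_
  · have : ∏ i, v (B (σ i) i) = 0 := Finset.prod_eq_zero (Finset.mem_univ (Fin.castAdd (n + 1) j))
      (by simp [hk, hB, hx])
    rw [this]
    positivity
  · rw [Fin.prod_univ_add]
    refine mul_le_mul ?_ ?_ (Finset.prod_nonneg fun _ _ ↦ v.nonneg _) (by positivity)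
    · refine (Finset.prod_le_prod (fun _ _ ↦ v.nonneg _) fun i _ ↦ hleft _ i).trans (by simp)
    · rw [← Finset.mul_prod_erase _ _ (Finset.mem_univ j), hk]
      refine mul_le_mul (hrow j) ?_ (Finset.prod_nonneg fun _ _ ↦ v.nonneg _)
        (mul_nonneg (by positivity) (v.nonneg _))
      refine (Finset.prod_le_prod (fun _ _ ↦ v.nonneg _) fun i hi ↦ hright _ i fun h ↦ ?_).trans
        (by simp)
      have := σ.injective (h.trans hk.symm)
      simp at hi
      exact hi (Fin.natAdd_injective _ _ this)

lemma coeff_coeff_swap {A : Type*} [CommRing A] (p : A[X][X]) (i j : ℕ) :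
    ((Bivariate.swap p).coeff i).coeff j = (p.coeff j).coeff i := by
  induction p using Polynomial.induction_on' with
  | add p r hp hr => simp [hp, hr]
  | monomial k a =>
    rw [Bivariate.swap_monomial, coeff_mul_C, coeff_map, coeff_C_mul_X_pow, coeff_monomial]
    simp only [eq_comm (a := k)]
    split_ifs <;> simp

lemma natDegree_swap_le_iff {A : Type*} [CommRing A] (p : A[X][X]) (k : ℕ) :
    (Bivariate.swap p).natDegree ≤ k ↔ ∀ i, (p.coeff i).natDegree ≤ k := by
  simp only [natDegree_le_iff_coeff_eq_zero]
  constructor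
  · intro h i j hj
    rw [← coeff_coeff_swap, h j hj, coeff_zero]
  · intro h j hj
    ext i
    rw [coeff_coeff_swap, h i j hj, coeff_zero]

lemma natDegree_swap {A : Type*} [CommRing A] (p : A[X][X]) :
    (Bivariate.swap p).natDegree = p.support.sup fun i ↦ (p.coeff i).natDegree := by
  refine eq_of_forall_ge_iff fun k ↦ ?_
  rw [natDegree_swap_le_iff, Finset.sup_le_iff]
  refine ⟨fun h i _ ↦ h i, fun h i ↦ ?_⟩
  by_cases hi : i ∈ p.support
  · exact h i hi
  · simp [notMem_support_iff.1 hi]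

lemma eval₂_swap {A L : Type*} [CommRing A] [CommRing L] (t : A →+* L) (x y : L) (p : A[X][X]) :
    eval₂ (eval₂RingHom t y) x (Bivariate.swap p) = eval₂ (eval₂RingHom t x) y p := by
  induction p using Polynomial.induction_on' with
  | add p r hp hr => simp [eval₂_add, hp, hr]
  | monomial k a =>
    rw [Bivariate.swap_monomial, eval₂_mul, eval₂_map, eval₂_C, eval₂_monomial]
    congr 1
    · rw [coe_eval₂RingHom]
      congr 1
      ext
      simp
    · simp

lemma resultant_ne_zero_of_eval₂ {A L : Type*} [CommRing A] [IsDomain A]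
    [UniqueFactorizationMonoid A] [Field L] {φ : A →+* L} (hφ : Function.Injective φ)
    {f g : A[X]} (hg : Irreducible g) (hg0 : g.natDegree ≠ 0) {x : L}
    (hgx : eval₂ φ x g = 0) (hfx : eval₂ φ x f ≠ 0) : resultant f g ≠ 0 := by
  let : NormalizationMonoid A := Classical.choice inferInstance
  let : NormalizedGCDMonoid A := UniqueFactorizationMonoid.toNormalizedGCDMonoid A
  let K := FractionRing A
  have hgK : Irreducible (g.map (algebraMap A K)) :=
    ((hg.isPrimitive hg0).irreducible_iff_irreducible_map_fraction_map).1 hg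
  let ψ : K →+* L := IsFractionRing.lift hφ
  have hψ : ψ.comp (algebraMap A K) = φ := by
    ext a
    exact IsFractionRing.lift_algebraMap hφ a
  have hcop : IsCoprime (f.map (algebraMap A K)) (g.map (algebraMap A K)) := by
    refine ((EuclideanDomain.dvd_or_coprime _ _ hgK).resolve_left fun ⟨r, hr⟩ ↦ hfx ?_).symm
    have := congr_arg (eval₂ ψ x) hr
    rwa [eval₂_mul, eval₂_map, eval₂_map, hψ, hgx, zero_mul] at this
  have h := resultant_ne_zero _ _ hcop
  rw [natDegree_map_eq_of_injective (IsFractionRing.injective A K),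
    natDegree_map_eq_of_injective (IsFractionRing.injective A K), resultant_map_map] at h
  exact fun h0 ↦ h (by rw [h0, map_zero])

end Resultant

section Transfer

variable {Fq : Type} [Field Fq] {q : ℕ}

/-- The exponent of the height: the maximal degree in `T` of the coefficients of `P`. -/
def heightDegree (P : Fq[X][X]) : ℕ :=
  P.support.sup fun i ↦ (P.coeff i).natDegree

lemma natDegree_coeff_le_heightDegree (P : Fq[X][X]) (i : ℕ) :
    (P.coeff i).natDegree ≤ heightDegree P :=
  (natDegree_swap_le_iff P _).1 (natDegree_swap P).le i

lemma heightP_of_ne_zero {P : Fq[X][X]} (hP : P ≠ 0) :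
    heightP Fq q P = (q : ℝ) ^ heightDegree P := by
  simp [heightP, hP, heightDegree]

lemma evalP_ne_zero {η : LaurentSeries Fq} (hη : ¬ IsAlgLS Fq η) {P : Fq[X][X]} (hP : P ≠ 0) :
    evalP Fq η P ≠ 0 :=
  fun h ↦ hη ⟨P, hP, h⟩

lemma absL_pos_iff (hq : 1 < q) {x : LaurentSeries Fq} : 0 < absL Fq q x ↔ x ≠ 0 :=
  (absValue Fq hq).pos_iff

lemma finite_setOf_heightDegree_le [Finite Fq] (n B : ℕ) :
    {P : Fq[X][X] | P.natDegree ≤ n ∧ heightDegree P ≤ B}.Finite := by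
  refine Set.Finite.of_injOn (f := fun P (i : Fin (n + 1)) (j : Fin (B + 1)) ↦ (P.coeff i).coeff j)
    (t := Set.univ) (fun _ _ ↦ Set.mem_univ _) ?_ Set.finite_univ
  rintro P ⟨hPn, hPB⟩ Q ⟨hQn, hQB⟩ h
  ext i j
  by_cases hi : i < n + 1
  · by_cases hj : j < B + 1
    · exact congr_fun (congr_fun h ⟨i, hi⟩) ⟨j, hj⟩
    · rw [coeff_eq_zero_of_natDegree_lt, coeff_eq_zero_of_natDegree_lt]
      · have := natDegree_coeff_le_heightDegree Q i
        lia
      · have := natDegree_coeff_le_heightDegree P i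
        lia
  · rw [coeff_eq_zero_of_natDegree_lt (p := P) (by lia),
      coeff_eq_zero_of_natDegree_lt (p := Q) (by lia)]

lemma exists_absValue_coeff_le (hq : 1 < q) (g : (LaurentSeries Fq)[X]) :
    ∃ c : ℝ, 1 ≤ c ∧ ∀ i, absValue Fq hq (g.coeff i) ≤ c := by
  have h0 : 0 ≤ ∑ j ∈ g.support, absValue Fq hq (g.coeff j) :=
    Finset.sum_nonneg fun i _ ↦ (absValue Fq hq).nonneg _
  refine ⟨1 + ∑ j ∈ g.support, absValue Fq hq (g.coeff j), by linarith, fun i ↦ ?_⟩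
  by_cases hi : i ∈ g.support
  · have := Finset.single_le_sum (f := fun j ↦ absValue Fq hq (g.coeff j))
      (fun i _ ↦ (absValue Fq hq).nonneg _) hi
    linarith
  · rw [notMem_support_iff.1 hi, map_zero]
    linarith

lemma evalXY_eq_eval₂_swap (ξ η : LaurentSeries Fq) (F : Fq[X][X][X]) :
    evalXY Fq ξ η F = eval₂ (eval₂RingHom (ringHomT Fq) η) ξ (Bivariate.swap F) :=
  (eval₂_swap _ _ _ _).symm

lemma degX_ne_zero {ξ η : LaurentSeries Fq} (hη : ¬ IsAlgLS Fq η) {F : Fq[X][X][X]} (hF0 : F ≠ 0)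
    (hF : evalXY Fq ξ η F = 0) : degX Fq F ≠ 0 := by
  intro h
  rw [degX, ← natDegree_swap] at h
  rw [evalXY_eq_eval₂_swap, eq_C_of_natDegree_eq_zero h, eval₂_C] at hF
  refine evalP_ne_zero hη (fun h0 ↦ hF0 ?_) hF
  rw [← map_eq_zero_iff _ Bivariate.swap.injective, eq_C_of_natDegree_eq_zero h, h0, C_0]

lemma natDegree_ne_zero_of_evalXY {ξ η : LaurentSeries Fq} (hξ : ¬ IsAlgLS Fq ξ)
    {F : Fq[X][X][X]} (hF0 : F ≠ 0) (hF : evalXY Fq ξ η F = 0) : F.natDegree ≠ 0 := by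
  intro h
  rw [evalXY, eq_C_of_natDegree_eq_zero h, eval₂_C] at hF
  refine evalP_ne_zero hξ (fun h0 ↦ hF0 ?_) hF
  rw [eq_C_of_natDegree_eq_zero h, h0, C_0]

/-- Eliminating `X` between `P(X)` and `F(X, Y)` yields a polynomial in `Y` of controlled degree
and height which is small at `η` when `P` is small at `ξ`. -/
lemma exists_eliminant (hq : 1 < q) {ξ η : LaurentSeries Fq} (hη : ¬ IsAlgLS Fq η)
    {F : Fq[X][X][X]} (hirr : Irreducible F) (hF : evalXY Fq ξ η F = 0)
    {M : ℕ} (hM : degX Fq F = M + 1) (n : ℕ) :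
    ∃ c₁ c₂ : ℕ, ∀ P : Fq[X][X], P.natDegree ≤ n → evalP Fq ξ P ≠ 0 → ∃ R : Fq[X][X],
      R.natDegree ≤ n * F.natDegree ∧ R ≠ 0 ∧
      heightDegree R ≤ (M + 1) * heightDegree P + c₂ ∧
      absL Fq q (evalP Fq η R) ≤
        (q : ℝ) ^ c₁ * absL Fq q (evalP Fq ξ P) * ((q : ℝ) ^ heightDegree P) ^ M := by
  set G : Fq[X][X][X] := Bivariate.swap F with hG
  set φ : Fq[X][X] →+* LaurentSeries Fq := eval₂RingHom (ringHomT Fq) η with hφ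
  have hφinj : Function.Injective φ := by
    rw [injective_iff_map_eq_zero]
    intro P hP
    by_contra h
    exact evalP_ne_zero hη h hP
  have hGdeg : G.natDegree = M + 1 := by rw [hG, natDegree_swap, ← hM, degX]
  have hGirr : Irreducible G := (MulEquiv.irreducible_iff Bivariate.swap).2 hirr
  have hGξ : eval₂ φ ξ G = 0 := by rw [← hF, evalXY_eq_eval₂_swap]
  have hGcoeff (i : ℕ) : (G.coeff i).natDegree ≤ F.natDegree := by
    refine (natDegree_swap_le_iff G _).1 ?_ i
    rw [hG, Bivariate.swap_swap_apply]
  obtain ⟨c, hc1, hc⟩ := exists_absValue_coeff_le hq (G.map φ)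
  set X₀ := max 1 (absValue Fq hq ξ)
  obtain ⟨c₁, hc₁⟩ := pow_unbounded_of_one_lt (c ^ n * X₀ ^ M)
    (show (1 : ℝ) < q by exact_mod_cast hq)
  set b : ℕ := G.support.sup fun i ↦ (Bivariate.swap (G.coeff i)).natDegree
  have hGb (i : ℕ) : (Bivariate.swap (G.coeff i)).natDegree ≤ b := by
    by_cases hi : i ∈ G.support
    · exact Finset.le_sup (f := fun i ↦ (Bivariate.swap (G.coeff i)).natDegree) hi
    · simp [notMem_support_iff.1 hi]
  refine ⟨c₁, n * b, fun P hPn hPξ ↦ ?_⟩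
  set f : Fq[X][X][X] := P.map C with hf
  have hfdeg : f.natDegree = P.natDegree := natDegree_map_eq_of_injective C_injective P
  have hfφ : f.map φ = P.map (ringHomT Fq) := by
    rw [hf, Polynomial.map_map]
    congr 1
    exact RingHom.ext fun a ↦ by simp [hφ]
  have hfξ : eval₂ φ ξ f = evalP Fq ξ P := by
    rw [← eval_map, hfφ, eval_map, evalP]
  refine ⟨resultant f G, ?_, ?_, ?_, ?_⟩
  · refine (natDegree_resultant_le f G _ _ 0 F.natDegree (by simp [hf]) hGcoeff).trans ?_
    rw [mul_zero, add_zero, hfdeg]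
    exact Nat.mul_le_mul_right _ hPn
  · exact resultant_ne_zero_of_eval₂ hφinj hGirr (by lia) hGξ (by rwa [hfξ])
  · rw [heightDegree, ← natDegree_swap]
    have h := resultant_map_map f G f.natDegree G.natDegree
      ((Bivariate.swap (R := Fq) : Fq[X][X] ≃ₐ[Fq] Fq[X][X]) : Fq[X][X] →+* Fq[X][X])
    rw [RingHom.coe_coe] at h
    rw [← h]
    refine (natDegree_resultant_le _ _ _ _ (heightDegree P) b (fun i ↦ ?_) fun i ↦ ?_).trans ?_
    · rw [coeff_map, hf, coeff_map, RingHom.coe_coe, Bivariate.swap_C]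
      exact natDegree_map_le.trans (natDegree_coeff_le_heightDegree P i)
    · rw [coeff_map]
      exact hGb i
    · rw [hGdeg, hfdeg, add_comm]
      gcongr
  · have hR : evalP Fq η (resultant f G) =
        resultant (f.map φ) (G.map φ) P.natDegree (M + 1) := by
      rw [resultant_map_map, hfdeg, hGdeg]
      rfl
    rw [hR, ← absValue_apply hq, ← absValue_apply hq]
    have h := map_resultant_le (isNonarchimedean_absValue hq) (f.map φ) (G.map φ) ξ
      (m := P.natDegree) (n := M) (H := (q : ℝ) ^ heightDegree P) (c := c)
      (natDegree_map_le.trans hfdeg.le) (natDegree_map_le.trans hGdeg.le)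
      (by rw [eval_map, hGξ]) (fun i ↦ ?_) hc
    · rw [eval_map, hfξ] at h
      have hv := (absValue Fq hq).nonneg (evalP Fq ξ P)
      calc _ ≤ _ := h
        _ ≤ c ^ n * (X₀ ^ M * absValue Fq hq (evalP Fq ξ P) * ((q : ℝ) ^ heightDegree P) ^ M) := by
          have := pow_le_pow_right₀ hc1 hPn
          gcongr
        _ = (c ^ n * X₀ ^ M) * absValue Fq hq (evalP Fq ξ P) *
            ((q : ℝ) ^ heightDegree P) ^ M := by ring
        _ ≤ _ := by gcongr
    · rw [hfφ, coeff_map]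
      refine (absValue_ringHomT_le hq _).trans ?_
      exact pow_le_pow_right₀ (by exact_mod_cast hq.le) (natDegree_coeff_le_heightDegree P i)

lemma wn_nonneg (hq : 1 < q) {η : LaurentSeries Fq} (hη : ¬ IsAlgLS Fq η) {n : ℕ} (hn : 1 ≤ n) :
    0 ≤ wn Fq q n η := by
  refine le_sSup ⟨0, ?_, rfl⟩
  choose a ha using fun k : ℕ ↦
    exists_absValue_sub_ringHomT_le_one hq (ringHomT Fq (X ^ k) * η)
  refine Set.infinite_of_injective_forall_mem
    (f := fun k : ℕ ↦ C ((X : Fq[X]) ^ k) * X + C (-a k)) (fun k l h ↦ ?_) fun k ↦ ?_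
  · have h1 := congr_arg (fun P : Fq[X][X] ↦ P.coeff 1) h
    simp [-map_pow] at h1
    simpa using congr_arg natDegree h1
  · have hne : C ((X : Fq[X]) ^ k) * X + C (-a k) ≠ 0 := by
      intro h
      have h1 := congr_arg (fun P : Fq[X][X] ↦ P.coeff 1) h
      simp [-map_pow] at h1
    refine ⟨natDegree_linear_le.trans hn, (absL_pos_iff hq).2 (evalP_ne_zero hη hne), ?_⟩
    rw [neg_zero, Real.rpow_zero]
    convert ha k using 1
    rw [absValue_apply]
    congr 1
    simp [-map_pow, evalP, sub_eq_add_neg]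

lemma mem_exponents_of_mem_exponents [Finite Fq] (hq : 1 < q) {ξ η : LaurentSeries Fq}
    (hη : ¬ IsAlgLS Fq η)
    {F : Fq[X][X][X]} (hirr : Irreducible F) (hF : evalXY Fq ξ η F = 0)
    {M : ℕ} (hM : degX Fq F = M + 1) (n : ℕ) {w w' : ℝ} (hw' : 0 ≤ w')
    (hww' : (M + 1) * w' < w - M)
    (hw : {P : Fq[X][X] | P.natDegree ≤ n ∧ 0 < absL Fq q (evalP Fq ξ P) ∧
      absL Fq q (evalP Fq ξ P) ≤ heightP Fq q P ^ (-w)}.Infinite) :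
    {R : Fq[X][X] | R.natDegree ≤ n * F.natDegree ∧ 0 < absL Fq q (evalP Fq η R) ∧
      absL Fq q (evalP Fq η R) ≤ heightP Fq q R ^ (-w')}.Infinite := by
  have hq1 : (1 : ℝ) < q := by exact_mod_cast hq
  have hq0 : (0 : ℝ) < q := by linarith
  obtain ⟨c₁, c₂, hc⟩ := exists_eliminant hq hη hirr hF hM n
  set δ : ℝ := w - M - (M + 1) * w' with hδ
  have hδ0 : 0 < δ := by linarith
  obtain ⟨B, hB⟩ := exists_nat_ge ((c₁ + w' * c₂) / δ)
  rw [div_le_iff₀ hδ0] at hB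
  set S := {P : Fq[X][X] | P.natDegree ≤ n ∧ 0 < absL Fq q (evalP Fq ξ P) ∧
      absL Fq q (evalP Fq ξ P) ≤ heightP Fq q P ^ (-w)} \
    {P | P.natDegree ≤ n ∧ heightDegree P ≤ B}
  have hSinf : S.Infinite := hw.sdiff (finite_setOf_heightDegree_le n B)
  choose! r hrdeg hr0 hrht hrabs using hc
  have hSne {P : Fq[X][X]} (hP : P ∈ S) : evalP Fq ξ P ≠ 0 := (absL_pos_iff hq).1 hP.1.2.1
  have hSB {P : Fq[X][X]} (hP : P ∈ S) : (B : ℝ) ≤ heightDegree P := by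
    have h : ¬ heightDegree P ≤ B := fun h ↦ hP.2 ⟨hP.1.1, h⟩
    exact_mod_cast (not_le.1 h).le
  have hle {P : Fq[X][X]} (hP : P ∈ S) : absL Fq q (evalP Fq η (r P)) ≤
      (q : ℝ) ^ (c₁ - (w - M) * heightDegree P : ℝ) := by
    have hP0 : P ≠ 0 := fun h ↦ hSne hP (by simp [h, evalP])
    have h1 := hP.1.2.2
    rw [heightP_of_ne_zero hP0] at h1
    calc _ ≤ _ := hrabs P hP.1.1 (hSne hP)
      _ ≤ (q : ℝ) ^ c₁ * ((q : ℝ) ^ heightDegree P) ^ (-w) * ((q : ℝ) ^ heightDegree P) ^ M := by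
        gcongr
      _ = _ := by
        rw [← Real.rpow_natCast, ← Real.rpow_natCast, ← Real.rpow_mul hq0.le,
          ← Real.rpow_natCast, ← Real.rpow_mul hq0.le, ← Real.rpow_add hq0, ← Real.rpow_add hq0]
        congr 1
        ring
  have himage : (r '' S).Infinite := by
    intro hfin
    refine hSinf (Set.Finite.of_finite_fibers r hfin fun R _ ↦ ?_)
    by_cases hR : R = 0
    · refine Set.Finite.subset Set.finite_empty ?_
      rintro P ⟨hP, hPR⟩
      exact hr0 P hP.1.1 (hSne hP) (hPR.trans hR)
    have hwM : 0 < w - M := by nlinarith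
    have hRη := (absL_pos_iff hq).2 (evalP_ne_zero hη hR)
    obtain ⟨D, hD⟩ := exists_nat_ge ((c₁ - Real.logb q (absL Fq q (evalP Fq η R))) / (w - M))
    refine (finite_setOf_heightDegree_le n D).subset ?_
    rintro P ⟨hP, hPR⟩
    refine ⟨hP.1.1, ?_⟩
    have h := hle hP
    rw [show r P = R from hPR, ← Real.logb_le_iff_le_rpow hq1 hRη] at h
    rw [div_le_iff₀ hwM] at hD
    have : (heightDegree P : ℝ) ≤ D := by nlinarith
    exact_mod_cast this
  refine himage.mono ?_
  rintro _ ⟨P, hP, rfl⟩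
  refine ⟨hrdeg P hP.1.1 (hSne hP),
    (absL_pos_iff hq).2 (evalP_ne_zero hη (hr0 P hP.1.1 (hSne hP))), (hle hP).trans ?_⟩
  rw [heightP_of_ne_zero (hr0 P hP.1.1 (hSne hP)), ← Real.rpow_natCast, ← Real.rpow_mul hq0.le]
  refine Real.rpow_le_rpow_of_exponent_le hq1.le ?_
  have h1 : (heightDegree (r P) : ℝ) ≤ (M + 1) * heightDegree P + c₂ := by
    exact_mod_cast hrht P hP.1.1 (hSne hP)
  have h2 := mul_le_mul_of_nonneg_right h1 hw'
  have h3 := mul_le_mul_of_nonneg_right (hSB hP) hδ0.le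
  have h4 : (heightDegree P : ℝ) * δ =
      (w - M) * heightDegree P - ((M + 1) * heightDegree P) * w' := by rw [hδ]; ring
  linarith

lemma wn_le_of_evalXY [Finite Fq] (hq : 1 < q) {ξ η : LaurentSeries Fq}
    (hξ : ¬ IsAlgLS Fq ξ) (hη : ¬ IsAlgLS Fq η)
    {F : Fq[X][X][X]} (hirr : Irreducible F) (hF : evalXY Fq ξ η F = 0) {n : ℕ} (hn : 1 ≤ n) :
    wn Fq q n ξ ≤ ((degX Fq F : ℝ) - 1 : ℝ) +
      (degX Fq F : EReal) * wn Fq q (n * F.natDegree) η := by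
  obtain ⟨M, hM⟩ := Nat.exists_eq_succ_of_ne_zero (degX_ne_zero hη hirr.ne_zero hF)
  have hN := natDegree_ne_zero_of_evalXY hξ hirr.ne_zero hF
  have hnonneg := wn_nonneg hq hη (Nat.mul_pos hn (Nat.pos_of_ne_zero hN))
  rw [hM]
  refine sSup_le ?_
  rintro _ ⟨w, hw, rfl⟩
  induction hW : wn Fq q (n * F.natDegree) η with
  | bot => simp [hW] at hnonneg
  | top =>
    rw [EReal.mul_top_of_pos (by exact_mod_cast Nat.succ_pos M), EReal.coe_add_top]
    exact le_top
  | coe s =>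
    rw [hW] at hnonneg
    have hs : 0 ≤ s := by exact_mod_cast hnonneg
    suffices h : w ≤ ((M.succ : ℕ) : ℝ) - 1 + ((M.succ : ℕ) : ℝ) * s by
      rw [← EReal.coe_natCast, ← EReal.coe_mul, ← EReal.coe_add]
      exact EReal.coe_le_coe_iff.2 h
    by_contra! h
    push_cast at h
    have hM0 : (0 : ℝ) < M + 1 := by positivity
    obtain ⟨w', hsw', hw'⟩ := exists_between (show s < (w - M) / (M + 1) by
      rw [lt_div_iff₀ hM0]; linarith)
    rw [lt_div_iff₀ hM0] at hw'
    have hmem := mem_exponents_of_mem_exponents hq hη hirr hF hM n (hs.trans hsw'.le)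
      (by linarith) hw
    have : (w' : EReal) ≤ wn Fq q (n * F.natDegree) η := le_sSup ⟨w', hmem, rfl⟩
    rw [hW] at this
    exact absurd (EReal.coe_le_coe_iff.1 this) (not_le.2 hsw')

end Transfer

section Limsup

variable {Fq : Type} [Field Fq] {q : ℕ}

lemma wB_nonneg (hq : 1 < q) {η : LaurentSeries Fq} (hη : ¬ IsAlgLS Fq η) : 0 ≤ wB Fq q η := by
  refine le_limsup_of_le (by isBoundedDefault) fun b hb ↦ ?_
  obtain ⟨n, hn, hn1⟩ := (hb.and (eventually_ge_atTop 1)).exists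
  exact (EReal.div_nonneg (wn_nonneg hq hη hn1) (by positivity)).trans hn

lemma wB_le_of_wn_le (hq : 1 < q) {ξ η : LaurentSeries Fq} (hη : ¬ IsAlgLS Fq η) {M N : ℕ}
    (hM : M ≠ 0) (hN : N ≠ 0)
    (h : ∀ n : ℕ, 1 ≤ n →
      wn Fq q n ξ ≤ (((M : ℝ) - 1 : ℝ) : EReal) + (M : EReal) * wn Fq q (n * N) η) :
    wB Fq q ξ ≤ ((M * N : ℕ) : EReal) * wB Fq q η := by
  have hMN : 0 < M * N := Nat.pos_of_ne_zero (mul_ne_zero hM hN)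
  have hnonneg := wB_nonneg hq hη
  induction hW : wB Fq q η with
  | bot => simp [hW] at hnonneg
  | top =>
    rw [EReal.mul_top_of_pos (by exact_mod_cast hMN)]
    exact le_top
  | coe s =>
    rw [← EReal.coe_natCast, ← EReal.coe_mul, ← EReal.le_of_forall_lt_iff_le]
    intro c hc
    rw [EReal.coe_lt_coe_iff] at hc
    have hMN' : (0 : ℝ) < (M * N : ℕ) := by exact_mod_cast hMN
    obtain ⟨b, hsb, hbc⟩ := exists_between ((lt_div_iff₀' hMN').2 hc)
    rw [lt_div_iff₀' hMN'] at hbc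
    push_cast at hbc
    have hlt : wB Fq q η < b := by
      rw [hW]
      exact_mod_cast hsb
    have hev := eventually_lt_of_limsup_lt hlt
    have hev' := (tendsto_id.atTop_mul_const' (Nat.pos_of_ne_zero hN)).eventually hev
    obtain ⟨n₀, hn₀⟩ := exists_nat_ge (((M : ℝ) - 1) / (c - M * N * b))
    rw [div_le_iff₀ (by linarith)] at hn₀
    refine limsup_le_of_le (by isBoundedDefault) ?_
    filter_upwards [hev', eventually_ge_atTop n₀, eventually_ge_atTop 1] with n hn hnn₀ hn1
    have hnN : (0 : ℝ) < (n * N : ℕ) := by exact_mod_cast Nat.mul_pos hn1 (Nat.pos_of_ne_zero hN)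
    have hr0 := wn_nonneg hq hη (Nat.mul_pos hn1 (Nat.pos_of_ne_zero hN))
    have hn' := (EReal.div_le_iff_le_mul (by exact_mod_cast hnN) (EReal.natCast_ne_top _)).1 hn.le
    simp only [id] at hn'
    have hbound := h n hn1
    rw [EReal.div_le_iff_le_mul (by exact_mod_cast hn1) (EReal.natCast_ne_top _)]
    rw [← EReal.coe_natCast, ← EReal.coe_mul] at hn' ⊢
    refine hbound.trans ?_
    induction hR : wn Fq q (n * N) η with
    | bot => simp [hR] at hr0
    | top => exact absurd (hR ▸ hn') (not_le.2 (EReal.coe_lt_top _))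
    | coe r =>
      rw [hR, EReal.coe_le_coe_iff] at hn'
      rw [← EReal.coe_natCast, ← EReal.coe_mul, ← EReal.coe_add, EReal.coe_le_coe_iff]
      push_cast at hn'
      have h1 : (n₀ : ℝ) ≤ n := by exact_mod_cast hnn₀
      have h2 := mul_le_mul_of_nonneg_right h1 (show 0 ≤ c - M * N * b by linarith)
      have h3 := mul_le_mul_of_nonneg_left hn' (show (0 : ℝ) ≤ M by positivity)
      linarith

end Limsup

end OotoT

/-- If `F(X,Y) ∈ (F_q[T])[X,Y]` is irreducible and primitive with
`F(ξ,η) = 0`, `M = deg_X F`, `N = deg_Y F`, then `w_n(ξ) ≤ M − 1 + M·w_{nN}(η)` for all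
`n ≥ 1`, and consequently `w(ξ) ≤ MN·w(η)`. -/
theorem wn_of_algDep (p : ℕ) (hp : p.Prime) (q : ℕ) (hq : ∃ e : ℕ, 0 < e ∧ q = p ^ e)
    (Fq : Type) [Field Fq] [Fintype Fq] [CharP Fq p] (hcard : Fintype.card Fq = q)
    (ξ η : LaurentSeries Fq) (hξ : ¬ IsAlgLS Fq ξ) (hη : ¬ IsAlgLS Fq η)
    (F : Polynomial (Polynomial (Polynomial Fq))) (hirr : Irreducible F)
    (hprim : IsPrimitiveXY Fq F) (hF : evalXY Fq ξ η F = 0)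
    (M N : ℕ) (hM : degX Fq F = M) (hN : F.natDegree = N) :
    (∀ n : ℕ, 1 ≤ n →
        wn Fq q n ξ ≤ (((M : ℝ) - 1 : ℝ) : EReal) + (M : EReal) * wn Fq q (n * N) η) ∧
      wB Fq q ξ ≤ ((M * N : ℕ) : EReal) * wB Fq q η := by
  have hq1 : 1 < q := by
    rw [← hcard]
    exact Fintype.one_lt_card
  subst hM hN
  have hn := fun (n : ℕ) (hn : 1 ≤ n) ↦ wn_le_of_evalXY hq1 hξ hη hirr hF hn
  exact ⟨hn, wB_le_of_wn_le hq1 hη (degX_ne_zero hη hirr.ne_zero hF)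
    (natDegree_ne_zero_of_evalXY hξ hirr.ne_zero hF) hn⟩
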